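/- Let G and H be finite directly indecomposable groups that are not isomorphic. Then the order of the automorphism group of G × H satisfies |Aut(G × H)| = |Aut(G)| * |Aut(H)| * |Hom(G, Z(H))| * |Hom(H, Z(G))|. -/

import Mathlib

/-- A group is *directly indecomposable* if it is nontrivial and whenever it is
isomorphic to a direct product `A × B` of two groups, one of `A`, `B` is trivial. -/
def DirectlyIndecomposable (G : Type u) [Group G] : Prop :=
  Nontrivial G ∧
    ∀ (A B : Type u) [Group A] [Group B],
      Nonempty (G ≃* (A × B)) → (Subsingleton A ∨ Subsingleton B)

theorem exists_isIdempotentElem_pow {M : Type*} [Monoid M] [Finite M] (u : M) :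
    ∃ n, n ≠ 0 ∧ IsIdempotentElem (u ^ n) := by
  obtain ⟨a, b, hab, h⟩ : ∃ a b : ℕ, a < b ∧ u ^ a = u ^ b := by
    obtain ⟨a, b, hne, h⟩ := Finite.exists_ne_map_eq_of_infinite (fun n : ℕ => u ^ n)
    rcases lt_or_gt_of_ne hne with hlt | hlt
    · exact ⟨a, b, hlt, h⟩
    · exact ⟨b, a, hlt, h.symm⟩
  obtain ⟨p, hp, rfl⟩ : ∃ p, p ≠ 0 ∧ b = a + p := ⟨b - a, by omega, by omega⟩
  have periodic (m : ℕ) : u ^ (a + p * m) = u ^ a := by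
    induction m with
    | zero => simp
    | succ m ih => rw [mul_add, mul_one, ← add_assoc, pow_add, ih, ← pow_add, ← h]
  have hle : a ≤ p * (a + 1) := by nlinarith [Nat.pos_of_ne_zero hp]
  obtain ⟨c, hc⟩ := Nat.exists_eq_add_of_le hle
  refine ⟨p * (a + 1), by simp [hp], ?_⟩
  calc u ^ (p * (a + 1)) * u ^ (p * (a + 1))
      = u ^ (a + p * (a + 1)) * u ^ c := by
        rw [← pow_add, ← pow_add]
        congr 1
        omega
    _ = u ^ (p * (a + 1)) := by rw [periodic, ← pow_add, ← hc]

namespace DirectlyIndecomposable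

variable {G H : Type u} [Group G] [Group H]

/-- A direct factor of a directly indecomposable group, given as a retract with normal image,
is trivial or the whole group. -/
theorem range_eq_bot_or_ker_eq_bot (hH : DirectlyIndecomposable H) {K : Type*} [Group K]
    (a : K →* H) (b : H →* K) (hba : Function.Bijective (b ∘ a)) (ha : a.range.Normal) :
    a.range = ⊥ ∨ b.ker = ⊥ := by
  have hdisj : Disjoint a.range b.ker := by
    rw [Subgroup.disjoint_def]
    rintro _ ⟨k, rfl⟩ hk
    have : k = 1 := hba.1 (by simpa [MonoidHom.mem_ker] using hk)
    simp [this]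
  have hcomm (x : a.range) (y : b.ker) : Commute (a.range.subtype x) (b.ker.subtype y) :=
    Subgroup.commute_of_normal_of_disjoint _ _ ha inferInstance hdisj _ _ x.2 y.2
  let f : a.range × b.ker →* H := a.range.subtype.noncommCoprod b.ker.subtype hcomm
  have hf : Function.Bijective f := by
    constructor
    · refine MonoidHom.noncommCoprod_injective _ _ hcomm |>.2 ⟨?_, ?_, ?_⟩
      · exact Subtype.val_injective
      · exact Subtype.val_injective
      · simpa using hdisj
    · intro h
      obtain ⟨k, hk⟩ := hba.2 (b h)
      refine ⟨(⟨a k, k, rfl⟩, ⟨(a k)⁻¹ * h, ?_⟩), ?_⟩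
      · simp only [Function.comp_apply] at hk
        simp [MonoidHom.mem_ker, hk]
      · simp [f]
  exact (hH.2 a.range b.ker ⟨(MulEquiv.ofBijective f hf).symm⟩).imp
    (@Subgroup.eq_bot_of_subsingleton H _ a.range) (@Subgroup.eq_bot_of_subsingleton H _ b.ker)

theorem nonempty_mulEquiv_of_bijective_comp (hG : DirectlyIndecomposable G)
    (hH : DirectlyIndecomposable H) (a : G →* H) (b : H →* G)
    (hba : Function.Bijective (b ∘ a)) (ha : a.range.Normal) : Nonempty (G ≃* H) := by
  have hinj : Function.Injective a := hba.1.of_comp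
  rcases hH.range_eq_bot_or_ker_eq_bot a b hba ha with h | h
  · have := hG.1
    obtain ⟨g, hg⟩ := exists_ne (1 : G)
    refine absurd (hinj ?_) hg
    rw [map_one, ← Subgroup.mem_bot, ← h]
    exact ⟨g, rfl⟩
  · have hb : Function.Bijective b := ⟨(MonoidHom.ker_eq_bot_iff b).1 h, hba.2.of_comp⟩
    exact ⟨(MulEquiv.ofBijective b hb).symm⟩

/-- Fitting's lemma for endomorphisms commuting with conjugation. -/
theorem injective_or_forall_fixed_eq_one [Finite G] (hG : DirectlyIndecomposable G)
    (u : Monoid.End G) (hu : ∀ x y, u (x * y * x⁻¹) = x * u y * x⁻¹) :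
    Function.Injective u ∨ ∀ g, u g = g → g = 1 := by
  have : Finite (Monoid.End G) := .of_injective (fun f : Monoid.End G => (f : G → G))
    DFunLike.coe_injective
  obtain ⟨n, hn, he⟩ := exists_isIdempotentElem_pow u
  have hconj (m : ℕ) (x y : G) : (u ^ m) (x * y * x⁻¹) = x * (u ^ m) y * x⁻¹ := by
    induction m with
    | zero => simp
    | succ m ih =>
      rw [pow_succ']
      change u ((u ^ m) _) = x * u ((u ^ m) y) * x⁻¹
      rw [ih, hu]
  have hfix (g : G) (hg : u g = g) (m : ℕ) : (u ^ m) g = g := by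
    induction m with
    | zero => simp
    | succ m ih =>
      rw [pow_succ']
      change u ((u ^ m) g) = g
      rw [ih, hg]
  let e : G →* G := u ^ n
  have hee (g : G) : e (e g) = e g := DFunLike.congr_fun he g
  have hnormal : e.range.subtype.range.Normal := by
    rw [Subgroup.range_subtype]
    exact ⟨by rintro _ ⟨y, rfl⟩ x; exact ⟨x * y * x⁻¹, hconj n x y⟩⟩
  have hid : ⇑e.rangeRestrict ∘ ⇑e.range.subtype = id := by
    ext ⟨_, y, rfl⟩
    exact hee y
  rcases hG.range_eq_bot_or_ker_eq_bot e.range.subtype e.rangeRestrict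
    (hid ▸ Function.bijective_id) hnormal with h | h
  · right
    intro g hg
    rw [Subgroup.range_subtype] at h
    rw [← Subgroup.mem_bot, ← h]
    exact ⟨g, hfix g hg n⟩
  · left
    rw [MonoidHom.ker_rangeRestrict, MonoidHom.ker_eq_bot_iff] at h
    obtain ⟨m, rfl⟩ := Nat.exists_eq_succ_of_ne_zero hn
    have hcomp : ⇑e = ⇑(u ^ m) ∘ ⇑u := by
      ext g
      simp only [e, pow_succ]
      rfl
    rw [hcomp] at h
    exact h.of_comp

/-- The diagonal component of an automorphism of `G × H` is bijective. -/
theorem bijective_fst_component [Finite G] (hG : DirectlyIndecomposable G)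
    (hH : DirectlyIndecomposable H) (hiso : IsEmpty (G ≃* H)) (φ : G × H ≃* G × H) :
    Function.Bijective fun g : G => (φ (g, 1)).1 := by
  let a (ψ : G × H ≃* G × H) : G →* G :=
    (MonoidHom.fst G H).comp (ψ.toMonoidHom.comp (MonoidHom.inl G H))
  let b : H →* G :=
    (MonoidHom.fst G H).comp (φ.symm.toMonoidHom.comp (MonoidHom.inr G H))
  let c : G →* H :=
    (MonoidHom.snd G H).comp (φ.toMonoidHom.comp (MonoidHom.inl G H))
  have commute_images (ψ : G × H ≃* G × H) (g : G) (h : H) :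
      Commute (ψ (g, 1)) (ψ (1, h)) := by
    rw [commute_iff_eq, ← map_mul, ← map_mul]
    simp
  let u : G →* G := (a φ.symm).comp (a φ)
  let v : G →* G := b.comp c
  have huv (g : G) : u g * v g = g := by
    have h1 : ((φ (g, 1)).1, (1 : H)) * ((1 : G), (φ (g, 1)).2) = φ (g, 1) := by simp
    have h2 := congrArg (fun x => (φ.symm x).1) h1
    rw [map_mul, Prod.fst_mul, MulEquiv.symm_apply_apply] at h2
    exact h2
  have hcomm (x y : G) : Commute (u x) (v y) :=
    (commute_images φ.symm (a φ x) (c y)).map (MonoidHom.fst G H)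
  have hconj (x y : G) : u (x * y * x⁻¹) = x * u y * x⁻¹ := by
    calc u (x * y * x⁻¹) = u x * (u y * v x) * (v x)⁻¹ * (u x)⁻¹ := by
          rw [map_mul, map_mul, map_inv]
          group
      _ = u x * (v x * u y) * (v x)⁻¹ * (u x)⁻¹ := by rw [(hcomm y x).eq]
      _ = (u x * v x) * u y * (u x * v x)⁻¹ := by group
      _ = x * u y * x⁻¹ := by rw [huv]
  rcases hG.injective_or_forall_fixed_eq_one u hconj with h | h
  · have h' : Function.Injective (⇑(a φ.symm) ∘ ⇑(a φ)) := h
    exact Finite.injective_iff_bijective.1 h'.of_comp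
  · have hv : Function.Injective v := by
      rw [injective_iff_map_eq_one]
      intro g hg
      apply h
      have hug := huv g
      rw [hg, mul_one] at hug
      exact hug
    refine absurd hiso (not_isEmpty_iff.2 ?_)
    refine hG.nonempty_mulEquiv_of_bijective_comp hH c b (Finite.injective_iff_bijective.1 hv) ⟨?_⟩
    rintro _ ⟨y, rfl⟩ x
    obtain ⟨⟨g, h⟩, hgh⟩ := φ.surjective (1, x)
    have hx : x = (φ (g, 1)).2 * (φ (1, h)).2 := by
      rw [← Prod.snd_mul, ← map_mul]
      simp [hgh]
    have hc : Commute (c y) (φ (1, h)).2 := (commute_images φ y h).map (MonoidHom.snd G H)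
    refine ⟨g * y * g⁻¹, ?_⟩
    calc c (g * y * g⁻¹) = c g * c y * (c g)⁻¹ := by simp
      _ = c g * (c y * (φ (1, h)).2) * ((φ (1, h)).2)⁻¹ * (c g)⁻¹ := by group
      _ = c g * ((φ (1, h)).2 * c y) * ((φ (1, h)).2)⁻¹ * (c g)⁻¹ := by rw [hc.eq]
      _ = (c g * (φ (1, h)).2) * c y * (c g * (φ (1, h)).2)⁻¹ := by group
      _ = x * c y * x⁻¹ := by rw [hx]; rfl

theorem bijective_snd_component [Finite H] (hG : DirectlyIndecomposable G)
    (hH : DirectlyIndecomposable H) (hiso : IsEmpty (G ≃* H)) (φ : G × H ≃* G × H) :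
    Function.Bijective fun h : H => (φ (1, h)).2 :=
  hH.bijective_fst_component hG ⟨fun e => hiso.false e.symm⟩
    ((MulEquiv.prodComm.trans φ).trans MulEquiv.prodComm)

/-- Fixed points of a composite `G → Z(H) → Z(G)` are trivial. -/
theorem fixed_eq_one_of_central [Finite G] (hG : DirectlyIndecomposable G)
    (hH : DirectlyIndecomposable H) (hiso : IsEmpty (G ≃* H))
    (c : G →* H) (b : H →* G) (hc : ∀ g, c g ∈ Subgroup.center H)
    (hb : ∀ h, b h ∈ Subgroup.center G) (g : G) (hg : b (c g) = g) : g = 1 := by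
  refine (hG.injective_or_forall_fixed_eq_one (b.comp c) ?_).resolve_left ?_ g hg
  · intro x y
    have hx := Subgroup.mem_center_iff.1 (hb (c x)) (b (c y))
    have hy := Subgroup.mem_center_iff.1 (hb (c y)) x
    change b (c (x * y * x⁻¹)) = x * b (c y) * x⁻¹
    simp only [map_mul, map_inv]
    rw [hy, ← hx]
    group
  · intro hinj
    refine absurd hiso (not_isEmpty_iff.2 ?_)
    refine hG.nonempty_mulEquiv_of_bijective_comp hH c b (Finite.injective_iff_bijective.1 hinj) ⟨?_⟩
    rintro _ ⟨y, rfl⟩ x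
    refine ⟨y, ?_⟩
    rw [Subgroup.mem_center_iff.1 (hc y) x]
    group

end DirectlyIndecomposable

/-- The endomorphism of `G × H` with invertible diagonal and central off-diagonal components. -/
def centralMatrixHom {G H : Type*} [Group G] [Group H]
    (p : ((MulAut G × MulAut H) × (G →* Subgroup.center H)) × (H →* Subgroup.center G)) :
    G × H →* G × H :=
  (p.1.1.1.toMonoidHom.prod ((Subgroup.center H).subtype.comp p.1.2)).noncommCoprod
    (((Subgroup.center G).subtype.comp p.2).prod p.1.1.2.toMonoidHom) fun g h =>
      Prod.ext (Subgroup.mem_center_iff.1 (p.2 h).2 _)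
        (Subgroup.mem_center_iff.1 (p.1.2 g).2 _).symm

theorem centralMatrixHom_apply {G H : Type*} [Group G] [Group H]
    (p : ((MulAut G × MulAut H) × (G →* Subgroup.center H)) × (H →* Subgroup.center G))
    (g : G) (h : H) :
    centralMatrixHom p (g, h) = (p.1.1.1 g * p.2 h, p.1.2 g * p.1.1.2 h) := rfl

theorem centralMatrixHom_injective {G H : Type*} [Group G] [Group H] :
    Function.Injective (centralMatrixHom (G := G) (H := H)) := by
  rintro ⟨⟨⟨α, δ⟩, γ⟩, β⟩ ⟨⟨⟨α', δ'⟩, γ'⟩, β'⟩ h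
  have hl (g : G) := DFunLike.congr_fun h (g, 1)
  have hr (k : H) := DFunLike.congr_fun h (1, k)
  simp only [centralMatrixHom_apply, map_one, OneMemClass.coe_one, mul_one, one_mul,
    Prod.mk.injEq] at hl hr
  obtain rfl : α = α' := MulEquiv.ext fun g => (hl g).1
  obtain rfl : δ = δ' := MulEquiv.ext fun k => (hr k).2
  obtain rfl : γ = γ' := MonoidHom.ext fun g => Subtype.ext (hl g).2
  obtain rfl : β = β' := MonoidHom.ext fun k => Subtype.ext (hr k).1
  rfl

theorem DirectlyIndecomposable.bijective_centralMatrixHom {G H : Type u} [Group G] [Group H]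
    [Finite G] [Finite H] (hG : DirectlyIndecomposable G) (hH : DirectlyIndecomposable H)
    (hiso : IsEmpty (G ≃* H))
    (p : ((MulAut G × MulAut H) × (G →* Subgroup.center H)) × (H →* Subgroup.center G)) :
    Function.Bijective (centralMatrixHom p) := by
  rw [← Finite.injective_iff_bijective, injective_iff_map_eq_one]
  obtain ⟨⟨⟨α, δ⟩, γ⟩, β⟩ := p
  rintro ⟨g, h⟩ hgh
  simp only [centralMatrixHom_apply, Prod.mk_eq_one] at hgh
  obtain ⟨h1, h2⟩ := hgh
  let c : G →* H := δ.symm.toMonoidHom.comp ((Subgroup.center H).subtype.comp γ)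
  let b : H →* G := α.symm.toMonoidHom.comp ((Subgroup.center G).subtype.comp β)
  have hc (x : G) : c x = δ.symm (γ x) := rfl
  have hb (y : H) : b y = α.symm (β y) := rfl
  have hch : c g = h⁻¹ := by
    rw [hc, MulEquiv.symm_apply_eq, map_inv]
    exact eq_inv_of_mul_eq_one_left h2
  have hbg : b h = g⁻¹ := by
    rw [hb, MulEquiv.symm_apply_eq, map_inv]
    exact eq_inv_of_mul_eq_one_right h1
  have hg : g = 1 := by
    refine hG.fixed_eq_one_of_central hH hiso c b (fun x => ?_) (fun y => ?_) g ?_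
    · rw [hc]
      refine Subgroup.mem_center_iff.2 fun y => δ.injective ?_
      simpa using Subgroup.mem_center_iff.1 (γ x).2 (δ y)
    · rw [hb]
      refine Subgroup.mem_center_iff.2 fun x => α.injective ?_
      simpa using Subgroup.mem_center_iff.1 (β y).2 (α x)
    · rw [hch, map_inv, hbg, inv_inv]
  subst hg
  rw [map_one, eq_comm, inv_eq_one] at hch
  rw [hch]
  rfl

theorem DirectlyIndecomposable.exists_centralMatrixHom_eq {G H : Type u} [Group G] [Group H]
    [Finite G] [Finite H] (hG : DirectlyIndecomposable G) (hH : DirectlyIndecomposable H)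
    (hiso : IsEmpty (G ≃* H)) (φ : MulAut (G × H)) :
    ∃ p, centralMatrixHom p = φ.toMonoidHom := by
  have hα := hG.bijective_fst_component hH hiso φ
  have hδ := hG.bijective_snd_component hH hiso φ
  have commute_images (g : G) (h : H) : Commute (φ (g, 1)) (φ (1, h)) := by
    rw [commute_iff_eq, ← map_mul, ← map_mul]
    simp
  let α : MulAut G := MulEquiv.ofBijective
    ((MonoidHom.fst G H).comp (φ.toMonoidHom.comp (MonoidHom.inl G H))) hα
  let δ : MulAut H := MulEquiv.ofBijective
    ((MonoidHom.snd G H).comp (φ.toMonoidHom.comp (MonoidHom.inr G H))) hδ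
  let γ : G →* Subgroup.center H :=
    ((MonoidHom.snd G H).comp (φ.toMonoidHom.comp (MonoidHom.inl G H))).codRestrict _ fun g => by
      refine Subgroup.mem_center_iff.2 fun y => ?_
      obtain ⟨h, rfl⟩ := hδ.2 y
      exact ((commute_images g h).map (MonoidHom.snd G H)).symm
  let β : H →* Subgroup.center G :=
    ((MonoidHom.fst G H).comp (φ.toMonoidHom.comp (MonoidHom.inr G H))).codRestrict _ fun h => by
      refine Subgroup.mem_center_iff.2 fun x => ?_
      obtain ⟨g, rfl⟩ := hα.2 x
      exact (commute_images g h).map (MonoidHom.fst G H)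
  refine ⟨(((α, δ), γ), β), MonoidHom.ext fun ⟨g, h⟩ => ?_⟩
  calc centralMatrixHom (((α, δ), γ), β) (g, h) = φ (g, 1) * φ (1, h) := rfl
    _ = φ (g, h) := by rw [← map_mul]; simp


/-- Let `G` and `H` be finite directly indecomposable groups that
are not isomorphic.  Then
`|Aut(G × H)| = |Aut G| * |Aut H| * |Hom(G, Z(H))| * |Hom(H, Z(G))|`. -/
theorem card_aut_prod_of_not_iso
    (G H : Type u) [Group G] [Group H] [Finite G] [Finite H]
    (hG : DirectlyIndecomposable G) (hH : DirectlyIndecomposable H)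
    (hiso : IsEmpty (G ≃* H)) :
    Nat.card (MulAut (G × H)) =
      Nat.card (MulAut G) * Nat.card (MulAut H) *
        Nat.card (G →* Subgroup.center H) * Nat.card (H →* Subgroup.center G) := by
  simp only [← Nat.card_prod]
  symm
  refine Nat.card_eq_of_bijective
    (fun p => MulEquiv.ofBijective (centralMatrixHom p) (hG.bijective_centralMatrixHom hH hiso p))
    ⟨fun p q hpq => centralMatrixHom_injective ?_, fun φ => ?_⟩
  · exact MonoidHom.ext fun x => DFunLike.congr_fun hpq x
  · obtain ⟨p, hp⟩ := hG.exists_centralMatrixHom_eq hH hiso φ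
    exact ⟨p, MulEquiv.ext fun x => DFunLike.congr_fun hp x⟩
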